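/- (Compactness of the MPI forward operator) Let β, μ₀, m₀ > 0, let G be an invertible real 3×3 matrix, let I ⊂ ℝ be a compact interval with positive length, let Ω ⊂ ℝ³ be a bounded Lebesgue-measurable set with positive Lebesgue measure, let x_s : I → ℝ³ be continuously differentiable, let R ∈ ℝ³ with R ≠ 0, and let 1 < l < ∞. Define the MPI kernel k(x,t) = −μ₀ m₀ Rᵀ F̃(G(x − x_s(t))) G ẋ_s(t) (with F̃ extended to ξ = 0 by (β/3)·I₃). Then every continuous linear operator A from L^l(Ω) (with respect to Lebesgue measure on Ω) to L²(I) (with respect to Lebesgue measure on I) satisfying, for every c ∈ L^l(Ω), (A c)(t) = ∫_Ω c(x) k(x,t) dx for almost every t ∈ I, is a compact operator. -/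

import Mathlib

open MeasureTheory Filter Matrix
open scoped Topology ENNReal

/-- The hyperbolic cotangent `coth y = cosh y / sinh y`. -/
noncomputable def coth (y : ℝ) : ℝ := Real.cosh y / Real.sinh y

/-- The dilated Langevin function `L_β`: `L_β z = coth (β z) - 1/(β z)` for `z ≠ 0`, `L_β 0 = 0`. -/
noncomputable def Lb (β z : ℝ) : ℝ := if z = 0 then 0 else coth (β * z) - 1 / (β * z)

/-- `L'_β z = 1/(β z²) - β/(sinh (β z))²` (the derivative of `L_β` away from `0`). -/
noncomputable def Lb' (β z : ℝ) : ℝ := 1 / (β * z ^ 2) - β / (Real.sinh (β * z)) ^ 2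

/-- The Euclidean norm on `ℝ³`. -/
noncomputable def enorm3 (ξ : Fin 3 → ℝ) : ℝ := Real.sqrt (∑ i, ξ i ^ 2)

/-- The matrix `F̃(ξ) = (L'_β(‖ξ‖)/‖ξ‖² − L_β(‖ξ‖)/‖ξ‖³)·ξξᵀ + (L_β(‖ξ‖)/‖ξ‖)·I₃` for `ξ ≠ 0`,
extended to `ξ = 0` by `(β/3)·I₃`. -/
noncomputable def Ftilde (β : ℝ) (ξ : Fin 3 → ℝ) : Matrix (Fin 3) (Fin 3) ℝ :=
  if ξ = 0 then (β / 3) • (1 : Matrix (Fin 3) (Fin 3) ℝ)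
  else (Lb' β (enorm3 ξ) / (enorm3 ξ) ^ 2 - Lb β (enorm3 ξ) / (enorm3 ξ) ^ 3) •
        Matrix.of (fun i j => ξ i * ξ j)
      + (Lb β (enorm3 ξ) / enorm3 ξ) • (1 : Matrix (Fin 3) (Fin 3) ℝ)

section Langevin

private lemma nonneg_of_hasDerivAt {f f' : ℝ → ℝ} (h0 : f 0 = 0)
    (hf : ∀ y, HasDerivAt f (f' y) y) (hf' : ∀ y, 0 ≤ y → 0 ≤ f' y) {y : ℝ} (hy : 0 ≤ y) :
    0 ≤ f y := by
  have hmono : MonotoneOn f (Set.Ici 0) := by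
    refine monotoneOn_of_deriv_nonneg (convex_Ici 0)
      (fun z _ => (hf z).continuousAt.continuousWithinAt)
      (fun z _ => (hf z).differentiableAt.differentiableWithinAt) fun z hz => ?_
    rw [(hf z).deriv]
    exact hf' z (interior_subset hz)
  simpa [h0] using hmono Set.self_mem_Ici hy hy

lemma sinh_le_mul_cosh {y : ℝ} (hy : 0 ≤ y) : Real.sinh y ≤ y * Real.cosh y := by
  refine sub_nonneg.1 (nonneg_of_hasDerivAt (f := fun y => y * Real.cosh y - Real.sinh y)
    (f' := fun y => y * Real.sinh y) (by simp) (fun z => ?_)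
    (fun z hz => mul_nonneg hz (Real.sinh_nonneg_iff.2 hz)) hy)
  exact (((hasDerivAt_id z).mul (Real.hasDerivAt_cosh z)).sub
    (Real.hasDerivAt_sinh z)).congr_deriv (by simp)

lemma cosh_sub_one_le {y : ℝ} (hy : 0 ≤ y) :
    Real.cosh y - 1 ≤ y ^ 2 / 2 * Real.cosh y := by
  refine sub_nonneg.1 (nonneg_of_hasDerivAt
    (f := fun y => y ^ 2 / 2 * Real.cosh y - (Real.cosh y - 1))
    (f' := fun y => y * Real.cosh y + y ^ 2 / 2 * Real.sinh y - Real.sinh y)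
    (by simp) (fun z => ?_) (fun z hz => ?_) hy)
  · exact ((((hasDerivAt_pow 2 z).div_const 2).mul (Real.hasDerivAt_cosh z)).sub
      ((Real.hasDerivAt_cosh z).sub_const 1)).congr_deriv (by simp)
  · have := mul_nonneg (sq_nonneg z) (Real.sinh_nonneg_iff.2 hz)
    linarith [sinh_le_mul_cosh hz]

lemma sinh_sub_self_le {y : ℝ} (hy : 0 ≤ y) :
    Real.sinh y - y ≤ y ^ 3 / 6 * Real.cosh y := by
  refine sub_nonneg.1 (nonneg_of_hasDerivAt
    (f := fun y => y ^ 3 / 6 * Real.cosh y - (Real.sinh y - y))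
    (f' := fun y => y ^ 2 / 2 * Real.cosh y + y ^ 3 / 6 * Real.sinh y - (Real.cosh y - 1))
    (by simp) (fun z => ?_) (fun z hz => ?_) hy)
  · exact ((((hasDerivAt_pow 3 z).div_const 6).mul (Real.hasDerivAt_cosh z)).sub
      ((Real.hasDerivAt_sinh z).sub (hasDerivAt_id z))).congr_deriv (by push_cast; ring)
  · have := mul_nonneg (pow_nonneg hz 3) (Real.sinh_nonneg_iff.2 hz)
    linarith [cosh_sub_one_le hz]

lemma half_sq_le_cosh_sub_one {y : ℝ} (hy : 0 ≤ y) : y ^ 2 / 2 ≤ Real.cosh y - 1 := by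
  refine sub_nonneg.1 (nonneg_of_hasDerivAt (f := fun y => Real.cosh y - 1 - y ^ 2 / 2)
    (f' := fun y => Real.sinh y - y) (by simp) (fun z => ?_)
    (fun z hz => sub_nonneg.2 (Real.self_le_sinh_iff.2 hz)) hy)
  exact (((Real.hasDerivAt_cosh z).sub_const 1).sub
    ((hasDerivAt_pow 2 z).div_const 2)).congr_deriv (by simp)

lemma cube_div_six_le_sinh_sub_self {y : ℝ} (hy : 0 ≤ y) : y ^ 3 / 6 ≤ Real.sinh y - y := by
  refine sub_nonneg.1 (nonneg_of_hasDerivAt (f := fun y => Real.sinh y - y - y ^ 3 / 6)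
    (f' := fun y => Real.cosh y - 1 - y ^ 2 / 2) (by simp) (fun z => ?_)
    (fun z hz => sub_nonneg.2 (half_sq_le_cosh_sub_one hz)) hy)
  exact (((Real.hasDerivAt_sinh z).sub (hasDerivAt_id z)).sub
    ((hasDerivAt_pow 3 z).div_const 6)).congr_deriv (by push_cast; ring)

private lemma tendsto_of_le_of_le_mul_cosh {f : ℝ → ℝ} {m : ℝ} (h₁ : ∀ y, 0 < y → m ≤ f y)
    (h₂ : ∀ y, 0 < y → f y ≤ m * Real.cosh y) : Tendsto f (𝓝[>] 0) (𝓝 m) := by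
  have h : Tendsto (fun y => m * Real.cosh y) (𝓝[>] 0) (𝓝 m) := by
    have : Continuous fun y => m * Real.cosh y := by fun_prop
    simpa using (this.tendsto 0).mono_left nhdsWithin_le_nhds
  exact tendsto_of_tendsto_of_tendsto_of_le_of_le' tendsto_const_nhds h
    (eventually_mem_nhdsWithin.mono fun y hy => h₁ y hy)
    (eventually_mem_nhdsWithin.mono fun y hy => h₂ y hy)

lemma tendsto_sinh_div_self : Tendsto (fun y => Real.sinh y / y) (𝓝[>] 0) (𝓝 1) := by
  refine tendsto_of_le_of_le_mul_cosh (fun y hy => ?_) fun y hy => ?_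
  · rw [le_div_iff₀ hy]
    linarith [Real.self_le_sinh_iff.2 hy.le]
  · rw [div_le_iff₀ hy]
    linarith [sinh_le_mul_cosh hy.le]

lemma tendsto_cosh_sub_one_div_sq :
    Tendsto (fun y => (Real.cosh y - 1) / y ^ 2) (𝓝[>] 0) (𝓝 (1 / 2)) := by
  refine tendsto_of_le_of_le_mul_cosh (fun y hy => ?_) fun y hy => ?_
  · rw [le_div_iff₀ (by positivity)]
    linarith [half_sq_le_cosh_sub_one hy.le]
  · rw [div_le_iff₀ (by positivity)]
    linarith [cosh_sub_one_le hy.le]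

lemma tendsto_sinh_sub_self_div_cube :
    Tendsto (fun y => (Real.sinh y - y) / y ^ 3) (𝓝[>] 0) (𝓝 (1 / 6)) := by
  refine tendsto_of_le_of_le_mul_cosh (fun y hy => ?_) fun y hy => ?_
  · rw [le_div_iff₀ (by positivity)]
    linarith [cube_div_six_le_sinh_sub_self hy.le]
  · rw [div_le_iff₀ (by positivity)]
    linarith [sinh_sub_self_le hy.le]

private lemma tendsto_const_mul_nhdsGT {β : ℝ} (hβ : 0 < β) :
    Tendsto (fun z => β * z) (𝓝[>] 0) (𝓝[>] 0) := by
  refine tendsto_nhdsWithin_of_tendsto_nhds_of_eventually_within _ ?_ ?_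
  · simpa using ((continuous_const_mul β).tendsto 0).mono_left nhdsWithin_le_nhds
  · exact eventually_mem_nhdsWithin.mono fun z hz => mul_pos hβ hz

lemma tendsto_Lb_div_self {β : ℝ} (hβ : 0 < β) :
    Tendsto (fun z => Lb β z / z) (𝓝[>] 0) (𝓝 (β / 3)) := by
  have h := (((tendsto_cosh_sub_one_div_sq.sub tendsto_sinh_sub_self_div_cube).div
    tendsto_sinh_div_self one_ne_zero).comp (tendsto_const_mul_nhdsGT hβ)).const_mul β
  rw [show β * ((1 / 2 - 1 / 6) / 1) = β / 3 by ring] at h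
  refine h.congr' (eventually_mem_nhdsWithin.mono fun z hz => ?_)
  have hz : 0 < z := hz
  have hs : Real.sinh (β * z) ≠ 0 := (Real.sinh_pos_iff.2 (mul_pos hβ hz)).ne'
  simp only [Function.comp, Lb, if_neg hz.ne', coth, Pi.div_apply]
  field_simp
  ring

lemma tendsto_Lb' {β : ℝ} (hβ : 0 < β) : Tendsto (Lb' β) (𝓝[>] 0) (𝓝 (β / 3)) := by
  have h := (((tendsto_sinh_sub_self_div_cube.mul (tendsto_sinh_div_self.add_const 1)).div
    (tendsto_sinh_div_self.pow 2) (by norm_num)).comp (tendsto_const_mul_nhdsGT hβ)).const_mul β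
  rw [show β * (1 / 6 * (1 + 1) / 1 ^ 2) = β / 3 by ring] at h
  refine h.congr' (eventually_mem_nhdsWithin.mono fun z hz => ?_)
  have hz : 0 < z := hz
  have hs : Real.sinh (β * z) ≠ 0 := (Real.sinh_pos_iff.2 (mul_pos hβ hz)).ne'
  simp only [Function.comp, Lb', Pi.div_apply]
  field_simp
  ring

lemma continuousAt_Lb {β z : ℝ} (hβ : 0 < β) (hz : 0 < z) : ContinuousAt (Lb β) z := by
  have h : ContinuousAt (fun z => Real.cosh (β * z) / Real.sinh (β * z) - 1 / (β * z)) z := by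
    have hs : Real.sinh (β * z) ≠ 0 := (Real.sinh_pos_iff.2 (mul_pos hβ hz)).ne'
    have : β * z ≠ 0 := (mul_pos hβ hz).ne'
    fun_prop (disch := assumption)
  refine h.congr ((eventually_ne_nhds hz.ne').mono fun w hw => ?_)
  simp [Lb, hw, coth]

lemma continuousAt_Lb' {β z : ℝ} (hβ : 0 < β) (hz : 0 < z) : ContinuousAt (Lb' β) z := by
  have hs : Real.sinh (β * z) ^ 2 ≠ 0 :=
    pow_ne_zero _ (Real.sinh_pos_iff.2 (mul_pos hβ hz)).ne'
  have : β * z ^ 2 ≠ 0 := by positivity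
  unfold Lb'
  fun_prop (disch := assumption)

end Langevin

section Ftilde

lemma continuous_enorm3 : Continuous enorm3 := by
  unfold enorm3
  fun_prop

lemma enorm3_pos {ξ : Fin 3 → ℝ} (hξ : ξ ≠ 0) : 0 < enorm3 ξ := by
  obtain ⟨i, hi⟩ := Function.ne_iff.1 hξ
  refine Real.sqrt_pos.2 (Finset.sum_pos' (fun j _ => sq_nonneg (ξ j)) ⟨i, Finset.mem_univ i, ?_⟩)
  exact sq_pos_of_ne_zero hi

lemma abs_apply_le_enorm3 (ξ : Fin 3 → ℝ) (i : Fin 3) : |ξ i| ≤ enorm3 ξ := by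
  rw [← Real.sqrt_sq_eq_abs]
  exact Real.sqrt_le_sqrt
    (Finset.single_le_sum (f := fun j => ξ j ^ 2) (fun j _ => sq_nonneg (ξ j)) (Finset.mem_univ i))

lemma Ftilde_apply_of_ne_zero (β : ℝ) {ξ : Fin 3 → ℝ} (hξ : ξ ≠ 0) (i j : Fin 3) :
    Ftilde β ξ i j =
      (Lb' β (enorm3 ξ) - Lb β (enorm3 ξ) / enorm3 ξ) * (ξ i / enorm3 ξ * (ξ j / enorm3 ξ))
        + Lb β (enorm3 ξ) / enorm3 ξ * (1 : Matrix (Fin 3) (Fin 3) ℝ) i j := by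
  have h := (enorm3_pos hξ).ne'
  simp only [Ftilde, if_neg hξ, Matrix.add_apply, Matrix.smul_apply, Matrix.of_apply, smul_eq_mul]
  field_simp

lemma continuous_Ftilde {β : ℝ} (hβ : 0 < β) : Continuous (Ftilde β) := by
  refine continuous_matrix fun i j => continuous_iff_continuousAt.2 fun ξ => ?_
  rcases eq_or_ne ξ 0 with rfl | hξ
  · rw [continuousAt_iff_punctured_nhds]
    have hr : Tendsto enorm3 (𝓝[≠] 0) (𝓝[>] 0) := by
      refine tendsto_nhdsWithin_of_tendsto_nhds_of_eventually_within _ ?_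
        (eventually_mem_nhdsWithin.mono fun ξ hξ => enorm3_pos hξ)
      simpa [enorm3] using (continuous_enorm3.tendsto 0).mono_left nhdsWithin_le_nhds
    have hL := (tendsto_Lb_div_self hβ).comp hr
    have hD : Tendsto (fun ξ => Lb' β (enorm3 ξ) - Lb β (enorm3 ξ) / enorm3 ξ) (𝓝[≠] 0) (𝓝 0) := by
      simpa using ((tendsto_Lb' hβ).comp hr).sub hL
    have hB : IsBoundedUnder (· ≤ ·) (𝓝[≠] (0 : Fin 3 → ℝ))
        (norm ∘ fun ξ => ξ i / enorm3 ξ * (ξ j / enorm3 ξ)) := by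
      refine isBoundedUnder_of_eventually_le (a := 1)
        (eventually_mem_nhdsWithin.mono fun ξ hξ => ?_)
      have h (k : Fin 3) : |ξ k / enorm3 ξ| ≤ 1 := by
        rw [abs_div, abs_of_pos (enorm3_pos hξ)]
        exact div_le_one_of_le₀ (abs_apply_le_enorm3 ξ k) (enorm3_pos hξ).le
      simpa only [Function.comp, Real.norm_eq_abs, abs_mul] using
        mul_le_one₀ (h i) (abs_nonneg _) (h j)
    have h := (hD.zero_mul_isBoundedUnder_le hB).add
      (hL.mul_const ((1 : Matrix (Fin 3) (Fin 3) ℝ) i j))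
    have h0 : Ftilde β 0 i j = 0 + β / 3 * (1 : Matrix (Fin 3) (Fin 3) ℝ) i j := by
      simp [Ftilde]
    rw [h0]
    exact h.congr' (eventually_mem_nhdsWithin.mono fun ξ hξ =>
      (Ftilde_apply_of_ne_zero β hξ i j).symm)
  · have hr := enorm3_pos hξ
    have hc : ContinuousAt enorm3 ξ := continuous_enorm3.continuousAt
    have h₁ : ContinuousAt (fun ξ => Lb β (enorm3 ξ)) ξ :=
      (continuousAt_Lb hβ hr).comp_of_eq hc rfl
    have h₂ : ContinuousAt (fun ξ => Lb' β (enorm3 ξ)) ξ :=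
      (continuousAt_Lb' hβ hr).comp_of_eq hc rfl
    have h (k : Fin 3) : ContinuousAt (fun ξ : Fin 3 → ℝ => ξ k / enorm3 ξ) ξ :=
      (continuous_apply k).continuousAt.div hc hr.ne'
    have h₃ := h₁.div hc hr.ne'
    refine (((h₂.sub h₃).mul ((h i).mul (h j))).add (h₃.mul
      (continuousAt_const (y := (1 : Matrix (Fin 3) (Fin 3) ℝ) i j)))).congr
      ((eventually_ne_nhds hξ).mono fun η hη => ?_)
    exact (Ftilde_apply_of_ne_zero β hη i j).symm

end Ftilde

section IntegralOperator

lemma exists_integral_abs_le_mul_norm {X : Type*} [MeasurableSpace X] {μ : Measure X}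
    [IsFiniteMeasure μ] {p : ℝ≥0∞} [hp : Fact (1 ≤ p)] :
    ∃ C : ℝ, 0 ≤ C ∧ ∀ c : Lp ℝ p μ, ∫ x, |c x| ∂μ ≤ C * ‖c‖ := by
  have hexp : (0 : ℝ) ≤ 1 / (1 : ℝ≥0∞).toReal - 1 / p.toReal := by
    rcases eq_or_ne p ⊤ with rfl | hpt
    · simp
    · have : 1 ≤ p.toReal := by simpa using ENNReal.toReal_mono hpt hp.out
      simpa using inv_le_one_of_one_le₀ this
  refine ⟨(μ Set.univ ^ (1 / (1 : ℝ≥0∞).toReal - 1 / p.toReal)).toReal,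
    ENNReal.toReal_nonneg, fun c => ?_⟩
  have h := eLpNorm_le_eLpNorm_mul_rpow_measure_univ hp.out (Lp.aestronglyMeasurable c)
  have htop : eLpNorm c p μ * μ Set.univ ^ (1 / (1 : ℝ≥0∞).toReal - 1 / p.toReal) ≠ ⊤ :=
    ENNReal.mul_ne_top (Lp.eLpNorm_ne_top c)
      (ENNReal.rpow_ne_top_of_nonneg hexp (measure_ne_top μ _))
  have h' := ENNReal.toReal_mono htop h
  rw [ENNReal.toReal_mul, ← Lp.norm_def, mul_comm] at h'
  refine le_trans (le_of_eq ?_) h'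
  rw [eLpNorm_one_eq_lintegral_enorm]
  exact integral_norm_eq_lintegral_enorm (Lp.aestronglyMeasurable c)

lemma integrable_coeFn_Lp {X : Type*} [MeasurableSpace X] {μ : Measure X}
    [IsFiniteMeasure μ] {p : ℝ≥0∞} [hp : Fact (1 ≤ p)] (c : Lp ℝ p μ) : Integrable c μ :=
  (Lp.memLp c).integrable hp.out

/-- Integration against a bounded function, as a continuous functional on `Lp`. -/
lemma exists_clm_eq_integral_mul {X : Type*} [MeasurableSpace X] {μ : Measure X}
    [IsFiniteMeasure μ] {p : ℝ≥0∞} [Fact (1 ≤ p)] {g : X → ℝ} {M : ℝ}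
    (hg : AEStronglyMeasurable g μ) (hM : ∀ᵐ x ∂μ, |g x| ≤ M) :
    ∃ φ : Lp ℝ p μ →L[ℝ] ℝ, ∀ c : Lp ℝ p μ, φ c = ∫ x, c x * g x ∂μ := by
  obtain ⟨C, -, hC⟩ := exists_integral_abs_le_mul_norm (μ := μ) (p := p)
  have hint (c : Lp ℝ p μ) : Integrable (fun x => c x * g x) μ :=
    (integrable_coeFn_Lp c).mul_bdd hg hM
  refine ⟨LinearMap.mkContinuous
    { toFun := fun c => ∫ x, c x * g x ∂μ
      map_add' := fun c d => ?_
      map_smul' := fun r c => ?_ } (|M| * C) fun c => ?_, fun c => rfl⟩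
  · rw [← integral_add (hint c) (hint d)]
    refine integral_congr_ae ((Lp.coeFn_add c d).mono fun x hx => ?_)
    simp only [hx, Pi.add_apply]
    ring
  · rw [RingHom.id_apply, smul_eq_mul, ← integral_const_mul]
    refine integral_congr_ae ((Lp.coeFn_smul r c).mono fun x hx => ?_)
    simp only [hx, Pi.smul_apply, smul_eq_mul]
    ring
  · calc ‖∫ x, c x * g x ∂μ‖ ≤ ∫ x, |M| * |c x| ∂μ := by
          refine norm_integral_le_of_norm_le ((integrable_coeFn_Lp c).abs.const_mul _)
            (hM.mono fun x hx => ?_)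
          rw [Real.norm_eq_abs, abs_mul, mul_comm]
          exact mul_le_mul_of_nonneg_right (hx.trans (le_abs_self M)) (abs_nonneg _)
      _ ≤ |M| * C * ‖c‖ := by
          rw [integral_const_mul, mul_assoc]
          gcongr
          exact hC c

lemma isCompactOperator_sum_smulRight {E F ι : Type*} [NormedAddCommGroup E] [NormedSpace ℝ E]
    [NormedAddCommGroup F] [NormedSpace ℝ F] (s : Finset ι) (φ : ι → E →L[ℝ] ℝ) (e : ι → F) :
    IsCompactOperator (∑ i ∈ s, (φ i).smulRight (e i) : E →L[ℝ] F) := by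
  have h : ∑ i ∈ s, (φ i).smulRight (e i) ∈ compactOperator (RingHom.id ℝ) E F :=
    Submodule.sum_mem _ fun i _ => (isCompactOperator_of_locallyCompactSpace_dom
      (φ i)).continuous_comp (g := fun r : ℝ => r • e i) (by fun_prop)
  exact h

/-- An integral operator with continuous kernel on a compact product, from `Lp` to `Lq`
of finite measures, is compact. -/
theorem isCompactOperator_of_continuousOn_kernel {X : Type*} [PseudoMetricSpace X]
    [MeasurableSpace X] [OpensMeasurableSpace X] {μ : Measure X}
    {Ω S : Set X} (hS : IsCompact S) (hΩ : MeasurableSet Ω) (hΩS : Ω ⊆ S) (hμ : μ Ω ≠ ⊤)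
    {ν : Measure ℝ} [IsFiniteMeasure ν] {a b : ℝ} (hν : ∀ᵐ t ∂ν, t ∈ Set.Icc a b) (hab : a ≤ b) {k : X → ℝ → ℝ}
    (hk : ContinuousOn (Function.uncurry k) (S ×ˢ Set.Icc a b))
    {p q : ℝ≥0∞} [Fact (1 ≤ p)] [Fact (1 ≤ q)]
    (A : Lp ℝ p (μ.restrict Ω) →L[ℝ] Lp ℝ q (ν))
    (hA : ∀ c : Lp ℝ p (μ.restrict Ω), ∀ᵐ t ∂ν,
      A c t = ∫ x in Ω, c x * k x t ∂μ) :
    IsCompactOperator A := by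
  have : IsFiniteMeasure (μ.restrict Ω) := isFiniteMeasure_restrict.2 hμ
  obtain ⟨C, hC0, hC⟩ := exists_integral_abs_le_mul_norm (μ := μ.restrict Ω) (p := p)
  have hSI := hS.prod (isCompact_Icc (a := a) (b := b))
  obtain ⟨M, hM⟩ := hSI.exists_bound_of_continuousOn hk
  have hmeas (t) (ht : t ∈ Set.Icc a b) : AEStronglyMeasurable (k · t) (μ.restrict Ω) := by
    refine ContinuousOn.aestronglyMeasurable_of_subset_isCompact ?_ hS hΩ hΩS
    exact hk.comp (f := fun x => (x, t)) (by fun_prop) fun x hx => ⟨hx, ht⟩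
  have hbound (t) (ht : t ∈ Set.Icc a b) : ∀ᵐ x ∂μ.restrict Ω, |k x t| ≤ M :=
    (ae_restrict_mem hΩ).mono fun x hx => hM (x, t) ⟨hΩS hx, ht⟩
  set K : ℝ := measureUnivNNReal ν ^ q.toReal⁻¹ * C with hK
  have hK0 : 0 ≤ K := by positivity
  suffices hA' : A ∈ closure {T : Lp ℝ p (μ.restrict Ω) →L[ℝ] Lp ℝ q ν | IsCompactOperator T} from
    isClosed_setOfPred_isCompactOperator.closure_subset hA'
  refine Metric.mem_closure_iff.2 fun ε hε => ?_
  set η : ℝ := ε / (2 * (K + 1)) with hη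
  have hη0 : 0 < η := by positivity
  obtain ⟨δ, hδ, hkδ⟩ := Metric.uniformContinuousOn_iff_le.1
    (hSI.uniformContinuousOn_of_continuous hk) η hη0
  set τ : ℕ → ℝ := fun i => min b (a + i * δ) with hτ
  have hτI (i : ℕ) : τ i ∈ Set.Icc a b :=
    ⟨le_min hab (le_add_of_nonneg_right (by positivity)), min_le_left _ _⟩
  choose φ hφ using fun i : ℕ =>
    exists_clm_eq_integral_mul (p := p) (hmeas (τ i) (hτI i)) (hbound (τ i) (hτI i))
  set J : ℕ → Set ℝ := fun i => {t | ⌊(t - a) / δ⌋₊ = i} with hJ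
  have hJm (i : ℕ) : MeasurableSet (J i) :=
    (Nat.measurable_floor.comp (by fun_prop : Measurable fun t : ℝ => (t - a) / δ))
      (measurableSet_singleton i)
  set N : ℕ := ⌊(b - a) / δ⌋₊ + 1 with hN
  set T : Lp ℝ p (μ.restrict Ω) →L[ℝ] Lp ℝ q ν :=
    ∑ i ∈ Finset.range N, (φ i).smulRight (indicatorConstLp q (hJm i) (measure_ne_top ν _) 1)
    with hT
  have hTc (c : Lp ℝ p (μ.restrict Ω)) : ∀ᵐ t ∂ν, T c t = φ ⌊(t - a) / δ⌋₊ c := by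
    have h₁ := Lp.coeFn_fun_finsetSum (Finset.range N)
      fun i => φ i c • indicatorConstLp q (hJm i) (measure_ne_top ν _) (1 : ℝ)
    have h₂ : ∀ᵐ t ∂ν, ∀ i, (φ i c • indicatorConstLp q (hJm i) (measure_ne_top ν _) (1 : ℝ)) t =
        φ i c * (J i).indicator (fun _ => 1) t := by
      refine ae_all_iff.2 fun i => ?_
      filter_upwards [Lp.coeFn_smul (φ i c) (indicatorConstLp q (hJm i) (measure_ne_top ν _)
        (1 : ℝ)), indicatorConstLp_coeFn (p := q) (hs := hJm i) (hμs := measure_ne_top ν _)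
        (c := (1 : ℝ))] with t h h'
      rw [h, Pi.smul_apply, h', smul_eq_mul]
    filter_upwards [h₁, h₂, hν] with t ht ht' htI
    have hTt : T c = ∑ i ∈ Finset.range N,
        φ i c • indicatorConstLp q (hJm i) (measure_ne_top ν _) (1 : ℝ) := by
      simp [hT]
    rw [hTt, ht, Finset.sum_congr rfl fun i _ => ht' i,
      Finset.sum_eq_single_of_mem ⌊(t - a) / δ⌋₊]
    · simp [hJ]
    · rw [Finset.mem_range, hN, Nat.lt_succ_iff]
      have := htI.2
      gcongr
    · intro i _ hi
      simp [hJ, hi.symm]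
  refine ⟨T, isCompactOperator_sum_smulRight _ _ _, ?_⟩
  have hle : ‖A - T‖ ≤ K * η := by
    refine ContinuousLinearMap.opNorm_le_bound _ (by positivity) fun c => ?_
    have hae : ∀ᵐ t ∂ν, ‖(A - T) c t‖ ≤ η * (C * ‖c‖) := by
      filter_upwards [hA c, hTc c, Lp.coeFn_sub (A c) (T c), hν]
        with t hAt hTt hsub ht
      rw [_root_.sub_apply, hsub, Pi.sub_apply, hAt, hTt, hφ, ← integral_sub
        ((integrable_coeFn_Lp c).mul_bdd (hmeas t ht) (hbound t ht))
        ((integrable_coeFn_Lp c).mul_bdd (hmeas _ (hτI _)) (hbound _ (hτI _)))]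
      have hdist : |t - τ ⌊(t - a) / δ⌋₊| ≤ δ := by
        have h₀ : 0 ≤ (t - a) / δ := div_nonneg (sub_nonneg.2 ht.1) hδ.le
        have h₁ := Nat.floor_le h₀
        have h₂ := Nat.lt_floor_add_one ((t - a) / δ)
        rw [le_div_iff₀ hδ] at h₁
        rw [div_lt_iff₀ hδ] at h₂
        have h₃ : τ ⌊(t - a) / δ⌋₊ = a + ⌊(t - a) / δ⌋₊ * δ :=
          min_eq_right (by linarith [ht.2])
        rw [h₃, abs_le]
        constructor <;> linarith
      refine (norm_integral_le_of_norm_le ((integrable_coeFn_Lp c).abs.const_mul η)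
        ((ae_restrict_mem hΩ).mono fun x hx => ?_)).trans ?_
      · rw [← mul_sub, Real.norm_eq_abs, abs_mul, mul_comm]
        gcongr
        refine hkδ (x, t) ⟨hΩS hx, ht⟩ (x, τ ⌊(t - a) / δ⌋₊) ⟨hΩS hx, hτI _⟩ ?_
        simpa [Prod.dist_eq, Real.dist_eq, hδ.le] using hdist
      · rw [integral_const_mul]
        gcongr
        exact hC c
    refine (Lp.norm_le_of_ae_bound (by positivity) hae).trans (le_of_eq ?_)
    rw [hK]
    ring
  rw [dist_eq_norm]
  calc ‖A - T‖ ≤ K * η := hle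
    _ ≤ (K + 1) * η := by gcongr; linarith
    _ = ε / 2 := by rw [hη]; field_simp
    _ < ε := half_lt_self hε

end IntegralOperator

/-- Compactness of the MPI forward operator: with the MPI kernel
`k(x,t) = −μ₀ m₀ Rᵀ F̃(G(x − xs(t))) G xs'(t)`, every continuous linear operator
`A : L^l(Ω) → L²([a,b])` satisfying `(A c)(t) = ∫_Ω c(x) k(x,t) dx` for a.e. `t` is a
compact operator. -/
theorem mpi_forward_operator_compact (β μ₀ m₀ : ℝ) (hβ : 0 < β) (hμ₀ : 0 < μ₀) (hm₀ : 0 < m₀)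
    (G : Matrix (Fin 3) (Fin 3) ℝ) (hG : IsUnit G.det)
    (a b : ℝ) (hab : a < b)
    (Ω : Set (Fin 3 → ℝ)) (hΩb : Bornology.IsBounded Ω) (hΩm : MeasurableSet Ω)
    (hΩpos : 0 < volume Ω)
    (xs xs' : ℝ → Fin 3 → ℝ)
    (hderiv : ∀ t ∈ Set.Icc a b, HasDerivWithinAt xs (xs' t) (Set.Icc a b) t)
    (hcont : ContinuousOn xs' (Set.Icc a b))
    (R : Fin 3 → ℝ) (hR : R ≠ 0)
    (l : ℝ≥0∞) (hl : 1 < l) (hl' : l ≠ ⊤) [Fact (1 ≤ l)]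
    (A : Lp ℝ l (volume.restrict Ω) →L[ℝ] Lp ℝ 2 (volume.restrict (Set.Icc a b)))
    (hA : ∀ c : Lp ℝ l (volume.restrict Ω),
      ∀ᵐ t ∂volume.restrict (Set.Icc a b),
        A c t = ∫ x in Ω, c x *
          (-(μ₀ * m₀) *
            (R ⬝ᵥ (Ftilde β (G.mulVec (x - xs t))).mulVec (G.mulVec (xs' t))))) :
    IsCompactOperator ⇑A := by
  have hF : Continuous fun y : (Fin 3 → ℝ) × (Fin 3 → ℝ) × (Fin 3 → ℝ) =>
      Ftilde β (G.mulVec (y.1 - y.2.1)) :=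
    (continuous_Ftilde hβ).comp
      (continuous_const.matrix_mulVec (continuous_fst.sub continuous_snd.fst))
  have hGv : Continuous fun y : (Fin 3 → ℝ) × (Fin 3 → ℝ) × (Fin 3 → ℝ) => G.mulVec y.2.2 :=
    continuous_const.matrix_mulVec continuous_snd.snd
  have hΦ : Continuous fun y : (Fin 3 → ℝ) × (Fin 3 → ℝ) × (Fin 3 → ℝ) => -(μ₀ * m₀) *
      (R ⬝ᵥ (Ftilde β (G.mulVec (y.1 - y.2.1))).mulVec (G.mulVec y.2.2)) :=
    (continuous_const.dotProduct (hF.matrix_mulVec hGv)).const_mul (-(μ₀ * m₀))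
  have hxs : ContinuousOn xs (Set.Icc a b) := fun t ht => (hderiv t ht).continuousWithinAt
  have hp : ContinuousOn (fun y : (Fin 3 → ℝ) × ℝ => (y.1, xs y.2, xs' y.2))
      (closure Ω ×ˢ Set.Icc a b) :=
    continuousOn_fst.prodMk ((hxs.comp continuousOn_snd fun y hy => hy.2).prodMk
      (hcont.comp continuousOn_snd fun y hy => hy.2))
  have hk := hΦ.comp_continuousOn hp
  exact isCompactOperator_of_continuousOn_kernel (k := fun x t => -(μ₀ * m₀) *
      (R ⬝ᵥ (Ftilde β (G.mulVec (x - xs t))).mulVec (G.mulVec (xs' t))))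
    hΩb.isCompact_closure hΩm subset_closure
    hΩb.measure_lt_top.ne (ae_restrict_mem measurableSet_Icc) hab.le hk A hA
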